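/- arXiv:1512.04069 — 2 statements merged into one kernel-verified Lean document; each statement's English description precedes it below -/
import Mathlib

section
/- Let p > 1 and let q satisfy 1/p + 1/q = 1, let μ, σ ∈ ℝ with μ + σ = λ, and let k_λ be a nonnegative measurable function on (0,∞)×(0,∞) that is homogeneous of degree −λ, with k_λ(σ) := ∫₀^∞ k_λ(1,t) t^{σ-1} dt satisfying 0 < k_λ(σ) < ∞. For i = 1, 2 let 0 ≤ aᵢ < bᵢ ≤ ∞ and let vᵢ : (aᵢ, bᵢ) → (0,∞) be differentiable with vᵢ′(s) > 0 for all s ∈ (aᵢ, bᵢ), vᵢ(s) → 0 as s → aᵢ⁺, and vᵢ(s) → ∞ as s → bᵢ⁻. Let f, g be nonnegative measurable functions on (a₁, b₁) and (a₂, b₂) respectively, such that 0 < ∫_{a₁}^{b₁} v₁(x)^{p(1−μ)−1} f(x)^p / v₁′(x)^{p−1} dx < ∞ and 0 < ∫_{a₂}^{b₂} v₂(y)^{q(1−σ)−1} g(y)^q / v₂′(y)^{q−1} dy < ∞. Then ∫_{a₂}^{b₂} ∫_{a₁}^{b₁} k_λ(v₁(x), v₂(y)) f(x) g(y) dx dy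 < k_λ(σ) · (∫_{a₁}^{b₁} v₁(x)^{p(1−μ)−1} f(x)^p / v₁′(x)^{p−1} dx)^{1/p} · (∫_{a₂}^{b₂} v₂(y)^{q(1−σ)−1} g(y)^q / v₂′(y)^{q−1} dy)^{1/q}. -/
open MeasureTheory Set Filter

theorem ae_rpow_eq_of_lintegral_mul_eq {α : Type*} [MeasurableSpace α] {μ : Measure α} {p q : ℝ}
    (hpq : p.HolderConjugate q) {f g : α → ENNReal} (hf : AEMeasurable f μ)
    (hg : AEMeasurable g μ) (hf0 : ∫⁻ a, f a ^ p ∂μ ≠ 0) (hf1 : ∫⁻ a, f a ^ p ∂μ ≠ ⊤)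
    (hg0 : ∫⁻ a, g a ^ q ∂μ ≠ 0) (hg1 : ∫⁻ a, g a ^ q ∂μ ≠ ⊤)
    (h : ∫⁻ a, f a * g a ∂μ = (∫⁻ a, f a ^ p ∂μ) ^ (1 / p) * (∫⁻ a, g a ^ q ∂μ) ^ (1 / q)) :
    ∀ᵐ a ∂μ, f a ^ p * (∫⁻ a, f a ^ p ∂μ)⁻¹ = g a ^ q * (∫⁻ a, g a ^ q ∂μ)⁻¹ := by
  set A := ∫⁻ a, f a ^ p ∂μ
  set B := ∫⁻ a, g a ^ q ∂μ
  set F := ENNReal.funMulInvSnorm f p μ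
  set G := ENNReal.funMulInvSnorm g q μ
  have hA0 : A ^ (1 / p) ≠ 0 := by simp [ENNReal.rpow_eq_zero_iff, hf0, hf1]
  have hA1 : A ^ (1 / p) ≠ ⊤ := ENNReal.rpow_ne_top_of_nonneg (one_div_nonneg.2 hpq.nonneg) hf1
  have hB0 : B ^ (1 / q) ≠ 0 := by simp [ENNReal.rpow_eq_zero_iff, hg0, hg1]
  have hB1 : B ^ (1 / q) ≠ ⊤ := ENNReal.rpow_ne_top_of_nonneg (one_div_nonneg.2 hpq.symm.nonneg) hg1
  have hF : ∫⁻ a, F a ^ p ∂μ = 1 := ENNReal.lintegral_rpow_funMulInvSnorm_eq_one hpq.pos hf0 hf1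
  have hG : ∫⁻ a, G a ^ q ∂μ = 1 :=
    ENNReal.lintegral_rpow_funMulInvSnorm_eq_one hpq.symm.pos hg0 hg1
  have hFm : AEMeasurable F μ := hf.mul_const _
  have hGm : AEMeasurable G μ := hg.mul_const _
  have hFG : ∫⁻ a, F a * G a ∂μ = 1 := by
    have : ∀ a, F a * G a = f a * g a * ((A ^ (1 / p))⁻¹ * (B ^ (1 / q))⁻¹) := fun a ↦ by
      simp only [F, G, ENNReal.funMulInvSnorm, A, B]; ring
    simp_rw [this]
    rw [lintegral_mul_const' _ _
      (ENNReal.mul_ne_top (ENNReal.inv_ne_top.2 hA0) (ENNReal.inv_ne_top.2 hB0)), h,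
      ← ENNReal.mul_inv (.inl hA0) (.inl hA1)]
    exact ENNReal.mul_inv_cancel (mul_ne_zero hA0 hB0) (ENNReal.mul_ne_top hA1 hB1)
  have hsum : ∫⁻ a, (F a ^ p / ENNReal.ofReal p + G a ^ q / ENNReal.ofReal q) ∂μ = 1 := by
    simp_rw [div_eq_mul_inv]
    rw [lintegral_add_left' ((hFm.pow_const p).mul_const _),
      lintegral_mul_const'' _ (hFm.pow_const p), lintegral_mul_const'' _ (hGm.pow_const q),
      hF, hG, one_mul, one_mul]
    exact hpq.inv_add_inv_ennreal
  have hae := ae_eq_of_ae_le_of_lintegral_le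
    (Eventually.of_forall fun a ↦ ENNReal.young_inequality (F a) (G a) hpq)
    (by rw [hFG]; simp)
    (((hFm.pow_const p).div_const _).add ((hGm.pow_const q).div_const _))
    (by rw [hFG, hsum])
  have hFt := ae_lt_top' (hFm.pow_const p) (by rw [hF]; simp)
  have hGt := ae_lt_top' (hGm.pow_const q) (by rw [hG]; simp)
  filter_upwards [hae, hFt, hGt] with a ha h1 h2
  rw [← ENNReal.funMulInvSnorm_rpow hpq.pos, ← ENNReal.funMulInvSnorm_rpow hpq.symm.pos]
  rcases (ENNReal.young_inequality_eq_iff _ _ hpq).1 ha with h | h | h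
  · simp [h.1, hpq.pos] at h1
  · simp [h.2, hpq.symm.pos] at h2
  · exact h

theorem lintegral_eq_zero_of_ae_eq_add_right {u : ℝ → ENNReal} {d : ℝ}
    (hd : 0 < d) (hper : ∀ᵐ s, u s = u (s + d)) (hfin : ∫⁻ s, u s ≠ ⊤) : ∫⁻ s, u s = 0 := by
  have hshift (a : ℝ) : ∫⁻ s in Iio a, u s = ∫⁻ s in Iio (a + d), u s := by
    rw [← lintegral_indicator measurableSet_Iio, ← lintegral_indicator measurableSet_Iio,
      ← lintegral_add_right_eq_self ((Iio (a + d)).indicator u) d]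
    refine lintegral_congr_ae ?_
    filter_upwards [hper] with s hs
    simp only [indicator, mem_Iio, add_lt_add_iff_right, hs]
  have hIco (a : ℝ) : ∫⁻ s in Ico a (a + d), u s = 0 := by
    have h : Iio (a + d) = Iio a ∪ Ico a (a + d) := (Iio_union_Ico_eq_Iio (by linarith)).symm
    have h2 := hshift a
    rw [h, lintegral_union measurableSet_Ico
      (by rw [Set.disjoint_left]; intro x hx hx'; exact absurd hx'.1 (not_le.2 hx))] at h2
    have h3 : ∫⁻ s in Iio a, u s ≠ ⊤ := ne_top_of_le_ne_top hfin (setLIntegral_le_lintegral _ _)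
    have h4 : (∫⁻ s in Iio a, u s) + 0 = (∫⁻ s in Iio a, u s) + ∫⁻ s in Ico a (a + d), u s := by
      rw [add_zero]; exact h2
    exact ((ENNReal.add_right_inj h3).1 h4).symm
  have hU : (⋃ n : ℤ, Ico (n • d) ((n + 1) • d)) = univ := iUnion_Ico_zsmul hd
  rw [← setLIntegral_univ, ← hU]
  refine le_antisymm ((lintegral_iUnion_le _ _).trans ?_) zero_le
  simp [add_mul, hIco]

/-- Strict form of Young's convolution inequality. -/
theorem lintegral_convolution_lt {p q : ℝ} (hpq : p.HolderConjugate q) {h P Q : ℝ → ENNReal}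
    (hh : Measurable h) (hP : Measurable P) (hQ : Measurable Q)
    (hh0 : ∫⁻ r, h r ≠ 0) (hh1 : ∫⁻ r, h r ≠ ⊤) (hP0 : ∫⁻ s, P s ^ p ≠ 0)
    (hP1 : ∫⁻ s, P s ^ p ≠ ⊤) (hQ0 : ∫⁻ t, Q t ^ q ≠ 0) (hQ1 : ∫⁻ t, Q t ^ q ≠ ⊤) :
    ∫⁻ t, ∫⁻ s, h (t - s) * P s * Q t <
      (∫⁻ r, h r) * (∫⁻ s, P s ^ p) ^ (1 / p) * (∫⁻ t, Q t ^ q) ^ (1 / q) := by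
  set A := ∫⁻ s, P s ^ p
  set B := ∫⁻ t, Q t ^ q
  set M := A ^ (1 / p) * B ^ (1 / q) with hM
  have hM1 : M ≠ ⊤ := ENNReal.mul_ne_top
    (ENNReal.rpow_ne_top_of_nonneg (one_div_nonneg.2 hpq.nonneg) hP1)
    (ENNReal.rpow_ne_top_of_nonneg (one_div_nonneg.2 hpq.symm.nonneg) hQ1)
  have hB' (r : ℝ) : ∫⁻ s, Q (s + r) ^ q = B := lintegral_add_right_eq_self (fun t ↦ Q t ^ q) r
  have hle (r : ℝ) : ∫⁻ s, P s * Q (s + r) ≤ M := by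
    have := ENNReal.lintegral_mul_le_Lp_mul_Lq volume hpq hP.aemeasurable
      (hQ.comp (measurable_id.add_const r)).aemeasurable
    simpa [hM, ← hB' r] using this
  have key : ∫⁻ t, ∫⁻ s, h (t - s) * P s * Q t = ∫⁻ r, h r * ∫⁻ s, P s * Q (s + r) := by
    rw [lintegral_lintegral_swap (by fun_prop)]
    have (s : ℝ) : ∫⁻ t, h (t - s) * P s * Q t = ∫⁻ r, h r * (P s * Q (s + r)) := by
      rw [← lintegral_add_left_eq_self _ s]
      simp [mul_assoc]
    simp_rw [this]
    rw [lintegral_lintegral_swap (by fun_prop)]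
    refine lintegral_congr fun r ↦ lintegral_const_mul _ (by fun_prop)
  rw [key, mul_assoc, ← hM, ← lintegral_mul_const _ hh]
  have hmono : ∀ r, h r * ∫⁻ s, P s * Q (s + r) ≤ h r * M := fun r ↦ mul_le_mul_right (hle r) _
  refine lt_of_le_of_ne (lintegral_mono hmono) fun heq ↦ ?_
  have hfin : ∫⁻ r, h r * M ≠ ⊤ := by
    rw [lintegral_mul_const _ hh]; exact ENNReal.mul_ne_top hh1 hM1
  have hae := ae_eq_of_ae_le_of_lintegral_le (Eventually.of_forall hmono) (heq ▸ hfin)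
    (by fun_prop) heq.ge
  have hht := ae_lt_top hh hh1
  obtain ⟨r₁, r₂, hr, h1, h2⟩ : ∃ r₁ r₂ : ℝ, r₁ < r₂ ∧ ∫⁻ s, P s * Q (s + r₁) = M ∧
      ∫⁻ s, P s * Q (s + r₂) = M := by
    by_contra! hcon
    have hsub : {r | ∫⁻ s, P s * Q (s + r) = M}.Subsingleton := by
      intro x hx y hy
      rcases lt_trichotomy x y with hxy | hxy | hxy
      · exact absurd hy (hcon _ _ hxy hx)
      · exact hxy
      · exact absurd hx (hcon _ _ hxy hy)
    refine hh0 ((lintegral_eq_zero_iff hh).2 ?_)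
    filter_upwards [hae, hht, measure_eq_zero_iff_ae_notMem.1 (hsub.measure_zero volume)]
      with r hr1 hr2 hr3
    by_contra hr0
    exact hr3 ((ENNReal.mul_right_inj hr0 hr2.ne).1 hr1)
  have main (r : ℝ) (hr : ∫⁻ s, P s * Q (s + r) = M) :
      ∀ᵐ s, P s ^ p * A⁻¹ = Q (s + r) ^ q * B⁻¹ := by
    have := ae_rpow_eq_of_lintegral_mul_eq (μ := volume) hpq (f := P) (g := fun s ↦ Q (s + r))
      hP.aemeasurable (by fun_prop) hP0 hP1 (by rwa [hB' r]) (by rwa [hB' r]) (by rw [hB' r, hr])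
    rwa [hB' r] at this
  have hper : ∀ᵐ s, Q (s + r₁) ^ q = Q (s + (r₂ - r₁) + r₁) ^ q := by
    filter_upwards [main r₁ h1, main r₂ h2] with s e1 e2
    rw [e1] at e2
    rw [show s + (r₂ - r₁) + r₁ = s + r₂ by ring]
    exact (ENNReal.mul_left_inj (by simpa using hQ1) (by simpa using hQ0)).1 e2
  have := lintegral_eq_zero_of_ae_eq_add_right (u := fun s ↦ Q (s + r₁) ^ q) (sub_pos.2 hr) hper
    (by rwa [hB' r₁])
  exact hQ0 (by rwa [hB' r₁] at this)

/-- Logarithmic parametrization of the domain of a strictly increasing substitution `v` onto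
`(0, ∞)`. -/
theorem exists_log_parametrization {a b : EReal} (hab : a < b) {S : Set ℝ}
    (hS : S = {x : ℝ | a < (x : EReal) ∧ (x : EReal) < b}) {v v' : ℝ → ℝ}
    (hvd : ∀ s ∈ S, HasDerivAt v (v' s) s) (hv' : ∀ s ∈ S, 0 < v' s)
    (hvpos : ∀ s ∈ S, 0 < v s)
    (hva : Tendsto v (comap (fun x : ℝ ↦ (x : EReal)) (nhdsWithin a (Ioi a))) (nhds 0))
    (hvb : Tendsto v (comap (fun x : ℝ ↦ (x : EReal)) (nhdsWithin b (Iio b))) atTop) :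
    ∃ w : ℝ → ℝ, Measurable w ∧ Measurable (fun s ↦ v' (w s)) ∧ (∀ s, w s ∈ S) ∧
      (∀ s, v (w s) = Real.exp s) ∧ ∀ G : ℝ → ENNReal,
        ∫⁻ x in S, G x = ∫⁻ s, ENNReal.ofReal (Real.exp s / v' (w s)) * G (w s) := by
  have hSo : IsOpen S := by
    rw [hS]
    exact isOpen_Ioo.preimage continuous_coe_real_ereal
  have hSc : S.OrdConnected := by
    rw [hS]
    exact ⟨fun x hx y hy z hz ↦ ⟨hx.1.trans_le (EReal.coe_le_coe_iff.2 hz.1),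
      (EReal.coe_le_coe_iff.2 hz.2).trans_lt hy.2⟩⟩
  have hcont : ContinuousOn v S := fun s hs ↦ (hvd s hs).continuousAt.continuousWithinAt
  have hmono : StrictMonoOn v S := by
    refine strictMonoOn_of_deriv_pos hSc.convex hcont fun x hx ↦ ?_
    rw [hSo.interior_eq] at hx
    rw [(hvd x hx).deriv]
    exact hv' x hx
  have hsmall (c : ℝ) (hc : 0 < c) : ∃ x ∈ S, v x < c := by
    obtain ⟨u, hu, hus⟩ := (mem_nhdsGT_iff_exists_Ioo_subset' hab).1
      (mem_comap_iff_compl.1 (hva (Iio_mem_nhds hc)))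
    obtain ⟨x, hx1, hx2⟩ := EReal.lt_iff_exists_real_btwn.1 (lt_min (mem_Ioi.1 hu) hab)
    refine ⟨x, hS ▸ ⟨hx1, hx2.trans_le (min_le_right _ _)⟩, ?_⟩
    by_contra hcon
    exact hus ⟨hx1, hx2.trans_le (min_le_left _ _)⟩ ⟨x, hcon, rfl⟩
  have hlarge (c : ℝ) : ∃ x ∈ S, c < v x := by
    obtain ⟨u, hu, hus⟩ := (mem_nhdsLT_iff_exists_Ioo_subset' hab).1
      (mem_comap_iff_compl.1 (hvb (Ioi_mem_atTop c)))
    obtain ⟨x, hx1, hx2⟩ := EReal.lt_iff_exists_real_btwn.1 (max_lt (mem_Iio.1 hu) hab)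
    refine ⟨x, hS ▸ ⟨(le_max_right _ _).trans_lt hx1, hx2⟩, ?_⟩
    by_contra hcon
    exact hus ⟨(le_max_left _ _).trans_lt hx1, hx2⟩ ⟨x, hcon, rfl⟩
  have hsurj (s : ℝ) : ∃ x ∈ S, v x = Real.exp s := by
    obtain ⟨x, hx, hxs⟩ := hsmall _ (Real.exp_pos s)
    obtain ⟨y, hy, hys⟩ := hlarge (Real.exp s)
    exact hSc.isPreconnected.intermediate_value hx hy hcont ⟨hxs.le, hys.le⟩
  choose w hwS hw using hsurj
  have hwmono : Monotone w := fun s t hst ↦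
    (hmono.le_iff_le (hwS s) (hwS t)).1 (by rw [hw, hw]; exact Real.exp_le_exp.2 hst)
  have hv'w : (fun s ↦ v' (w s)) = fun s ↦ deriv v (w s) :=
    funext fun s ↦ (hvd _ (hwS s)).deriv.symm
  have hwlog (x : ℝ) (hx : x ∈ S) : w (Real.log (v x)) = x :=
    hmono.injOn (hwS _) hx (by rw [hw, Real.exp_log (hvpos x hx)])
  refine ⟨w, hwmono.measurable, ?_, hwS, hw, fun G ↦ ?_⟩
  · rw [hv'w]
    exact (measurable_deriv v).comp hwmono.measurable
  have himage : (fun x ↦ Real.log (v x)) '' S = univ :=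
    eq_univ_of_forall fun s ↦ ⟨w s, hwS s, by simp [hw]⟩
  have hcv := lintegral_image_eq_lintegral_abs_deriv_mul hSo.measurableSet
    (fun x hx ↦ ((hvd x hx).log (hvpos x hx).ne').hasDerivWithinAt)
    (fun x hx y hy hxy ↦ by rw [← hwlog x hx, ← hwlog y hy]; exact congrArg w hxy)
    (fun s ↦ ENNReal.ofReal (Real.exp s / v' (w s)) * G (w s))
  rw [himage, setLIntegral_univ] at hcv
  rw [hcv]
  refine setLIntegral_congr_fun hSo.measurableSet fun x hx ↦ ?_
  have h1 := hvpos x hx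
  have h2 := hv' x hx
  simp only [hwlog x hx, Real.exp_log h1]
  rw [← mul_assoc, ← ENNReal.ofReal_mul (abs_nonneg _), abs_of_pos (div_pos h2 h1),
    div_mul_div_cancel₀' h2.ne', div_self h1.ne', ENNReal.ofReal_one, one_mul]

theorem lintegral_log_parametrization_rpow {p mu : ℝ} (hp : 0 < p) {S : Set ℝ}
    {v v' w f : ℝ → ℝ} (hwS : ∀ s, w s ∈ S) (hw : ∀ s, v (w s) = Real.exp s)
    (hv' : ∀ s ∈ S, 0 < v' s) (hf : ∀ s ∈ S, 0 ≤ f s)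
    (hG : ∀ G : ℝ → ENNReal,
      ∫⁻ x in S, G x = ∫⁻ s, ENNReal.ofReal (Real.exp s / v' (w s)) * G (w s)) :
    ∫⁻ s, ENNReal.ofReal (Real.exp ((1 - mu) * s) * f (w s) / v' (w s)) ^ p =
      ∫⁻ x in S, ENNReal.ofReal (v x ^ (p * (1 - mu) - 1) * f x ^ p / v' x ^ (p - 1)) := by
  rw [hG]
  refine lintegral_congr fun s ↦ ?_
  have h1 := hv' _ (hwS s)
  have h2 := hf _ (hwS s)
  rw [ENNReal.ofReal_rpow_of_nonneg (by positivity) hp.le, ← ENNReal.ofReal_mul (by positivity), hw,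
    Real.div_rpow (by positivity) h1.le, Real.mul_rpow (by positivity) h2, ← Real.exp_mul,
    ← Real.exp_mul, Real.rpow_sub_one h1.ne',
    show (1 - mu) * s * p = s + s * (p * (1 - mu) - 1) by ring, Real.exp_add]
  congr 1
  have := Real.rpow_pos_of_pos h1 p
  field_simp

theorem lintegral_Ioi_eq_lintegral_exp (G : ℝ → ENNReal) :
    ∫⁻ t in Ioi (0 : ℝ), G t = ∫⁻ r, ENNReal.ofReal (Real.exp r) * G (Real.exp r) := by
  have := lintegral_image_eq_lintegral_abs_deriv_mul MeasurableSet.univ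
    (fun x _ ↦ (Real.hasDerivAt_exp x).hasDerivWithinAt) Real.exp_injective.injOn G
  simpa [image_univ, Real.range_exp] using this


/-- Yang–Hilbert-type inequality with homogeneous kernel of degree `-λ` and multi-variable
substitutions `vᵢ : (aᵢ,bᵢ) → (0,∞)`:
`∫∫ k_λ(v₁(x), v₂(y)) f(x) g(y) dx dy
  < k_λ(σ) (∫ v₁^{p(1-μ)-1} f^p / v₁'^{p-1})^{1/p} (∫ v₂^{q(1-σ)-1} g^q / v₂'^{q-1})^{1/q}`. -/
theorem stmt8 (p q lam mu σ : ℝ) (hp : 1 < p) (hpq : 1 / p + 1 / q = 1)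
    (hms : mu + σ = lam)
    (k : ℝ → ℝ → ℝ) (hkm : Measurable (Function.uncurry k))
    (hk0 : ∀ x y : ℝ, 0 < x → 0 < y → 0 ≤ k x y)
    (hhom : ∀ t x y : ℝ, 0 < t → 0 < x → 0 < y → k (t * x) (t * y) = t ^ (-lam) * k x y)
    (hK0 : 0 < ∫⁻ t in Ioi (0 : ℝ), ENNReal.ofReal (k 1 t * t ^ (σ - 1)))
    (hK1 : (∫⁻ t in Ioi (0 : ℝ), ENNReal.ofReal (k 1 t * t ^ (σ - 1))) < ⊤)
    (a₁ b₁ a₂ b₂ : EReal) (ha₁ : 0 ≤ a₁) (hab₁ : a₁ < b₁) (ha₂ : 0 ≤ a₂) (hab₂ : a₂ < b₂)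
    (S₁ S₂ : Set ℝ)
    (hS₁ : S₁ = {x : ℝ | a₁ < (x : EReal) ∧ (x : EReal) < b₁})
    (hS₂ : S₂ = {y : ℝ | a₂ < (y : EReal) ∧ (y : EReal) < b₂})
    (v₁ v₂ v₁' v₂' : ℝ → ℝ)
    (hv₁d : ∀ s ∈ S₁, HasDerivAt v₁ (v₁' s) s) (hv₁' : ∀ s ∈ S₁, 0 < v₁' s)
    (hv₂d : ∀ s ∈ S₂, HasDerivAt v₂ (v₂' s) s) (hv₂' : ∀ s ∈ S₂, 0 < v₂' s)
    (hv₁pos : ∀ s ∈ S₁, 0 < v₁ s) (hv₂pos : ∀ s ∈ S₂, 0 < v₂ s)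
    (hv₁a : Tendsto v₁ (Filter.comap (fun x : ℝ => (x : EReal)) (nhdsWithin a₁ (Ioi a₁)))
      (nhds (0 : ℝ)))
    (hv₁b : Tendsto v₁ (Filter.comap (fun x : ℝ => (x : EReal)) (nhdsWithin b₁ (Iio b₁)))
      atTop)
    (hv₂a : Tendsto v₂ (Filter.comap (fun y : ℝ => (y : EReal)) (nhdsWithin a₂ (Ioi a₂)))
      (nhds (0 : ℝ)))
    (hv₂b : Tendsto v₂ (Filter.comap (fun y : ℝ => (y : EReal)) (nhdsWithin b₂ (Iio b₂)))
      atTop)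
    (f g : ℝ → ℝ) (hf : Measurable f) (hg : Measurable g)
    (hf0 : ∀ x ∈ S₁, 0 ≤ f x) (hg0 : ∀ y ∈ S₂, 0 ≤ g y)
    (hA0 : 0 < ∫⁻ x in S₁,
      ENNReal.ofReal (v₁ x ^ (p * (1 - mu) - 1) * f x ^ p / v₁' x ^ (p - 1)))
    (hA1 : (∫⁻ x in S₁,
      ENNReal.ofReal (v₁ x ^ (p * (1 - mu) - 1) * f x ^ p / v₁' x ^ (p - 1))) < ⊤)
    (hB0 : 0 < ∫⁻ y in S₂,
      ENNReal.ofReal (v₂ y ^ (q * (1 - σ) - 1) * g y ^ q / v₂' y ^ (q - 1)))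
    (hB1 : (∫⁻ y in S₂,
      ENNReal.ofReal (v₂ y ^ (q * (1 - σ) - 1) * g y ^ q / v₂' y ^ (q - 1))) < ⊤) :
    (∫⁻ y in S₂, ∫⁻ x in S₁, ENNReal.ofReal (k (v₁ x) (v₂ y) * f x * g y))
      < (∫⁻ t in Ioi (0 : ℝ), ENNReal.ofReal (k 1 t * t ^ (σ - 1))) *
          (∫⁻ x in S₁,
            ENNReal.ofReal (v₁ x ^ (p * (1 - mu) - 1) * f x ^ p / v₁' x ^ (p - 1))) ^ (1 / p) *
          (∫⁻ y in S₂,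
            ENNReal.ofReal (v₂ y ^ (q * (1 - σ) - 1) * g y ^ q / v₂' y ^ (q - 1))) ^ (1 / q) := by
  have hpq' : p.HolderConjugate q := Real.holderConjugate_iff.2 ⟨hp, by simpa using hpq⟩
  obtain ⟨w₁, hw₁m, hd₁m, hw₁S, hw₁, hG₁⟩ :=
    exists_log_parametrization hab₁ hS₁ hv₁d hv₁' hv₁pos hv₁a hv₁b
  obtain ⟨w₂, hw₂m, hd₂m, hw₂S, hw₂, hG₂⟩ :=
    exists_log_parametrization hab₂ hS₂ hv₂d hv₂' hv₂pos hv₂a hv₂b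
  rw [← lintegral_log_parametrization_rpow hpq'.pos hw₁S hw₁ hv₁' hf0 hG₁] at hA0 hA1 ⊢
  rw [← lintegral_log_parametrization_rpow hpq'.symm.pos hw₂S hw₂ hv₂' hg0 hG₂] at hB0 hB1 ⊢
  have hK : ∫⁻ t in Ioi (0 : ℝ), ENNReal.ofReal (k 1 t * t ^ (σ - 1)) =
      ∫⁻ r, ENNReal.ofReal (k 1 (Real.exp r) * Real.exp (σ * r)) := by
    rw [lintegral_Ioi_eq_lintegral_exp]
    refine lintegral_congr fun r ↦ ?_
    rw [← ENNReal.ofReal_mul (Real.exp_pos r).le, ← Real.exp_mul,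
      show σ * r = r + r * (σ - 1) by ring, Real.exp_add]
    ring_nf
  rw [hK] at hK0 hK1 ⊢
  have hh : Measurable fun r ↦ ENNReal.ofReal (k 1 (Real.exp r) * Real.exp (σ * r)) := by
    have : Measurable fun r ↦ k 1 (Real.exp r) :=
      hkm.comp (measurable_const.prodMk Real.measurable_exp)
    fun_prop
  have hP : Measurable fun s ↦
      ENNReal.ofReal (Real.exp ((1 - mu) * s) * f (w₁ s) / v₁' (w₁ s)) :=
    (((Real.measurable_exp.comp (measurable_id.const_mul _)).mul
      (hf.comp hw₁m)).div hd₁m).ennreal_ofReal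
  have hQ : Measurable fun t ↦
      ENNReal.ofReal (Real.exp ((1 - σ) * t) * g (w₂ t) / v₂' (w₂ t)) :=
    (((Real.measurable_exp.comp (measurable_id.const_mul _)).mul
      (hg.comp hw₂m)).div hd₂m).ennreal_ofReal
  refine lt_of_eq_of_lt ?_ (lintegral_convolution_lt hpq' hh hP hQ hK0.ne' hK1.ne hA0.ne' hA1.ne
    hB0.ne' hB1.ne)
  rw [hG₂]
  refine lintegral_congr fun t ↦ ?_
  rw [hG₁, ← lintegral_const_mul' _ _ ENNReal.ofReal_ne_top]
  refine lintegral_congr fun s ↦ ?_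
  have hd₁ := hv₁' _ (hw₁S s)
  have hd₂ := hv₂' _ (hw₂S t)
  have hfs := hf0 _ (hw₁S s)
  have hgt := hg0 _ (hw₂S t)
  have hkts := hk0 1 (Real.exp (t - s)) one_pos (Real.exp_pos _)
  have hkst : k (Real.exp s) (Real.exp t) = Real.exp (s * -lam) * k 1 (Real.exp (t - s)) := by
    have := hhom (Real.exp s) 1 (Real.exp (t - s)) (Real.exp_pos _) one_pos (Real.exp_pos _)
    rwa [mul_one, ← Real.exp_add, add_sub_cancel, ← Real.exp_mul] at this
  rw [hw₁, hw₂, hkst, ← ENNReal.ofReal_mul (by positivity), ← ENNReal.ofReal_mul (by positivity),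
    ← ENNReal.ofReal_mul (by positivity), ← ENNReal.ofReal_mul (by positivity)]
  congr 1
  have hexp : Real.exp t * Real.exp s * Real.exp (s * -lam) =
      Real.exp (σ * (t - s)) * Real.exp ((1 - mu) * s) * Real.exp ((1 - σ) * t) := by
    simp only [← Real.exp_add, ← hms]
    ring_nf
  calc
    _ = Real.exp t * Real.exp s * Real.exp (s * -lam) *
        (k 1 (Real.exp (t - s)) * f (w₁ s) * g (w₂ t) / (v₁' (w₁ s) * v₂' (w₂ t))) := by
      field_simp
    _ = _ := by
      rw [hexp]
      field_simp
end

section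
/- Let p > 1 and let q satisfy 1/p + 1/q = 1, let σ ∈ ℝ, and let h be a nonnegative Lebesgue-measurable function on (0,∞) with k⁽²⁾(σ) := ∫₁^∞ h(t) t^{σ-1} dt satisfying 0 < k⁽²⁾(σ) < ∞. Let f, g be nonnegative measurable functions on (0,∞) such that 0 < ∫₀^∞ x^{p(1−σ)−1} f(x)^p dx < ∞ and 0 < ∫₀^∞ y^{q(1−σ)−1} g(y)^q dy < ∞. Then ∫₀^∞ (∫_{1/y}^∞ h(x·y) f(x) dx) g(y) dy < k⁽²⁾(σ) · (∫₀^∞ x^{p(1−σ)−1} f(x)^p dx)^{1/p} · (∫₀^∞ y^{q(1−σ)−1} g(y)^q dy)^{1/q}, where the inner integral is over x ∈ (1/y, ∞). -/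
open MeasureTheory Set

/-- The equality case of Hölder's inequality for functions with finite nonzero norms. -/
theorem ae_eq_of_lintegral_mul_eq_Lp_mul_Lq {α : Type*} [MeasurableSpace α] {μ : Measure α}
    {p q : ℝ} (hpq : p.HolderConjugate q) {u v : α → ENNReal}
    (hu : Measurable u) (hv : Measurable v)
    (hu0 : (∫⁻ a, u a ^ p ∂μ) ≠ 0) (hu1 : (∫⁻ a, u a ^ p ∂μ) ≠ ⊤)
    (hv0 : (∫⁻ a, v a ^ q ∂μ) ≠ 0) (hv1 : (∫⁻ a, v a ^ q ∂μ) ≠ ⊤)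
    (heq : ∫⁻ a, u a * v a ∂μ = (∫⁻ a, u a ^ p ∂μ) ^ (1 / p) * (∫⁻ a, v a ^ q ∂μ) ^ (1 / q)) :
    ∀ᵐ a ∂μ, u a ^ p * (∫⁻ a, u a ^ p ∂μ)⁻¹ = v a ^ q * (∫⁻ a, v a ^ q ∂μ)⁻¹ := by
  set F := ENNReal.funMulInvSnorm u p μ with hF
  set G := ENNReal.funMulInvSnorm v q μ with hG
  have hFm : Measurable F := hu.mul_const _
  have hGm : Measurable G := hv.mul_const _
  have hF1 : ∫⁻ a, F a ^ p ∂μ = 1 := ENNReal.lintegral_rpow_funMulInvSnorm_eq_one hpq.pos hu0 hu1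
  have hG1 : ∫⁻ a, G a ^ q ∂μ = 1 :=
    ENNReal.lintegral_rpow_funMulInvSnorm_eq_one hpq.symm.pos hv0 hv1
  have hFG : ∫⁻ a, F a * G a ∂μ = 1 := by
    set A := (∫⁻ a, u a ^ p ∂μ) ^ (1 / p) with hA
    set B := (∫⁻ a, v a ^ q ∂μ) ^ (1 / q) with hB
    have hA0 : A ≠ 0 := by simp [hA, hu0, hu1]
    have hA1 : A ≠ ⊤ := by simp [hA, hu0, hu1]
    have hB0 : B ≠ 0 := by simp [hB, hv0, hv1]
    have hB1 : B ≠ ⊤ := by simp [hB, hv0, hv1]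
    calc ∫⁻ a, F a * G a ∂μ = ∫⁻ a, u a * v a * (A⁻¹ * B⁻¹) ∂μ := by
          refine lintegral_congr fun a => ?_
          simp only [hF, hG, ENNReal.funMulInvSnorm]
          ring
      _ = (A * A⁻¹) * (B * B⁻¹) := by
          rw [lintegral_mul_const _ (by fun_prop), heq]
          ring
      _ = 1 := by rw [ENNReal.mul_inv_cancel hA0 hA1, ENNReal.mul_inv_cancel hB0 hB1, one_mul]
  have hsum : ∫⁻ a, F a ^ p / ENNReal.ofReal p + G a ^ q / ENNReal.ofReal q ∂μ = 1 := by
    simp only [div_eq_mul_inv]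
    rw [lintegral_add_left ((hFm.pow_const p).mul_const _),
      lintegral_mul_const _ (hFm.pow_const p), lintegral_mul_const _ (hGm.pow_const q),
      hF1, hG1, one_mul, one_mul, hpq.inv_add_inv_ennreal]
  have hae := ae_eq_of_ae_le_of_lintegral_le
    (Filter.Eventually.of_forall fun a => ENNReal.young_inequality (F a) (G a) hpq)
    (hFG.trans_ne ENNReal.one_ne_top)
    (((hFm.pow_const p).div_const _).add ((hGm.pow_const q).div_const _)).aemeasurable
    (by rw [hsum, hFG])
  have hFt : ∀ᵐ a ∂μ, F a ^ p < ⊤ := ae_lt_top (hFm.pow_const p) (by simp [hF1])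
  have hGt : ∀ᵐ a ∂μ, G a ^ q < ⊤ := ae_lt_top (hGm.pow_const q) (by simp [hG1])
  filter_upwards [hae, hFt, hGt] with a ha haF haG
  rw [← ENNReal.funMulInvSnorm_rpow hpq.pos, ← ENNReal.funMulInvSnorm_rpow hpq.symm.pos]
  rcases (ENNReal.young_inequality_eq_iff _ _ hpq).1 ha with h1 | h1 | h1
  · simp [h1.1, hpq.pos] at haF
  · simp [h1.2, hpq.symm.pos] at haG
  · exact h1

/-- An integrable function that is almost everywhere periodic has integral zero. -/
theorem lintegral_eq_zero_of_ae_periodic {P : ℝ → ENNReal}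
    (hfin : ∫⁻ x, P x ≠ ⊤) {d : ℝ} (hd : 0 < d) (hper : ∀ᵐ x : ℝ, P (x + d) = P x) :
    ∫⁻ x, P x = 0 := by
  have hpiece (R : ℝ) : ∫⁻ x in Ioc R (R + d), P x = 0 := by
    have hshift : ∫⁻ x in Ioi R, P x = ∫⁻ x in Ioi (R + d), P x := by
      rw [← lintegral_indicator measurableSet_Ioi, ← lintegral_indicator measurableSet_Ioi,
        ← lintegral_add_right_eq_self ((Ioi (R + d)).indicator P) d]
      refine lintegral_congr_ae ?_
      filter_upwards [hper] with x hx
      simp [indicator, hx]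
    have hsplit : ∫⁻ x in Ioi R, P x
        = (∫⁻ x in Ioc R (R + d), P x) + ∫⁻ x in Ioi (R + d), P x := by
      rw [← Ioc_union_Ioi_eq_Ioi (by linarith : R ≤ R + d),
        lintegral_union measurableSet_Ioi (Ioc_disjoint_Ioi le_rfl)]
    have htail : ∫⁻ x in Ioi (R + d), P x ≠ ⊤ :=
      ne_top_of_le_ne_top hfin (setLIntegral_le_lintegral _ _)
    rw [hshift] at hsplit
    exact ((ENNReal.add_left_inj htail).1 ((zero_add _).trans hsplit)).symm
  rw [← setLIntegral_univ, ← iUnion_Ioc_add_zsmul hd 0, ← nonpos_iff_eq_zero]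
  refine (lintegral_iUnion_le _ _).trans ?_
  simp only [nonpos_iff_eq_zero, ENNReal.tsum_eq_zero]
  intro n
  have hn : (0 : ℝ) + (n + 1) • d = (0 + n • d) + d := by rw [add_smul, one_smul]; ring
  rw [hn]
  exact hpiece _

/-- Strict form of Young's convolution inequality on the real line, with an integrable factor. -/
theorem lintegral_convolution_lt_s12 {p q : ℝ} (hpq : p.HolderConjugate q) {w u v : ℝ → ENNReal}
    (hw : Measurable w) (hu : Measurable u) (hv : Measurable v)
    (hw0 : (∫⁻ t, w t) ≠ 0) (hw1 : (∫⁻ t, w t) ≠ ⊤)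
    (hu0 : (∫⁻ t, u t ^ p) ≠ 0) (hu1 : (∫⁻ t, u t ^ p) ≠ ⊤)
    (hv0 : (∫⁻ t, v t ^ q) ≠ 0) (hv1 : (∫⁻ t, v t ^ q) ≠ ⊤) :
    ∫⁻ y, (∫⁻ x, w (x + y) * u x) * v y
      < (∫⁻ t, w t) * (∫⁻ t, u t ^ p) ^ (1 / p) * (∫⁻ t, v t ^ q) ^ (1 / q) := by
  set C := (∫⁻ t, u t ^ p) ^ (1 / p) * (∫⁻ t, v t ^ q) ^ (1 / q) with hC
  have hCtop : C ≠ ⊤ := by simp [hC, ENNReal.mul_eq_top, hu0, hu1, hv0, hv1]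
  set J : ℝ → ENNReal := fun t => ∫⁻ y, u (t - y) * v y with hJ
  have hrefl (t : ℝ) : ∫⁻ y, u (t - y) ^ p = ∫⁻ y, u y ^ p :=
    lintegral_sub_left_eq_self (fun y => u y ^ p) t
  have hum (t : ℝ) : Measurable fun y => u (t - y) := by fun_prop
  have hJC (t : ℝ) : J t ≤ C := by
    have := ENNReal.lintegral_mul_le_Lp_mul_Lq volume hpq (hum t).aemeasurable hv.aemeasurable
    rwa [hrefl] at this
  have hcases {t₁ t₂ : ℝ} (ht : t₁ < t₂) (h1 : J t₁ = C) (h2 : J t₂ = C) : False := by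
    have key {t : ℝ} (h : J t = C) := ae_eq_of_lintegral_mul_eq_Lp_mul_Lq hpq (hum t) hv
      (by rwa [hrefl]) (by rwa [hrefl]) hv0 hv1 (by rw [hrefl]; exact h)
    have hae : ∀ᵐ y : ℝ, u (t₂ - y) ^ p = u (t₁ - y) ^ p := by
      filter_upwards [key h1, key h2] with y hy1 hy2
      rw [hrefl] at hy1 hy2
      exact (ENNReal.mul_left_inj (ENNReal.inv_ne_zero.2 hu1) (ENNReal.inv_ne_top.2 hu0)).1
        (hy2.trans hy1.symm)
    refine hu0 (lintegral_eq_zero_of_ae_periodic hu1 (sub_pos.2 ht) ?_)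
    filter_upwards [(Measure.measurePreserving_sub_left volume t₁).quasiMeasurePreserving.ae hae] with x hx
    convert hx using 3 <;> ring
  have hlt : ∀ᵐ t : ℝ, J t < C := by
    have hsub : {t | J t = C}.Subsingleton := fun t₁ h1 t₂ h2 => by
      rcases lt_trichotomy t₁ t₂ with h | h | h
      · exact (hcases h h1 h2).elim
      · exact h
      · exact (hcases h h2 h1).elim
    filter_upwards [compl_mem_ae_iff.2 (hsub.measure_zero volume)] with t ht
    exact lt_of_le_of_ne (hJC t) ht
  have hswap : ∫⁻ y, (∫⁻ x, w (x + y) * u x) * v y = ∫⁻ t, w t * J t := by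
    calc ∫⁻ y, (∫⁻ x, w (x + y) * u x) * v y
        = ∫⁻ y, ∫⁻ t, w t * (u (t - y) * v y) := by
          refine lintegral_congr fun y => ?_
          rw [← lintegral_sub_right_eq_self (fun x => w (x + y) * u x) y,
            ← lintegral_mul_const _ (by fun_prop)]
          simp [mul_assoc]
      _ = ∫⁻ t, ∫⁻ y, w t * (u (t - y) * v y) :=
          lintegral_lintegral_swap (by fun_prop)
      _ = ∫⁻ t, w t * J t :=
          lintegral_congr fun t => lintegral_const_mul _ (by fun_prop)
  rw [hswap, mul_assoc, ← hC, ← lintegral_mul_const _ hw]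
  have hle : ∀ t, w t * J t ≤ w t * C := fun t => by gcongr; exact hJC t
  have hfin : ∫⁻ t, w t * C ≠ ⊤ := by
    rw [lintegral_mul_const _ hw]
    exact ENNReal.mul_ne_top hw1 hCtop
  refine lintegral_strict_mono_of_ae_le_of_ae_lt_on (s := {t | w t ≠ 0}) (by fun_prop)
    (ne_top_of_le_ne_top hfin (lintegral_mono hle)) (Filter.Eventually.of_forall hle) ?_ ?_
  · exact fun h0 => hw0 ((lintegral_eq_zero_iff hw).2 h0)
  · filter_upwards [hlt, ae_lt_top hw hw1] with t ht hwt ht0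
    exact ENNReal.mul_lt_mul_right ht0 hwt.ne ht

theorem lintegral_Ioi_exp (a : ℝ) (Φ : ℝ → ENNReal) :
    ∫⁻ x in Ioi (Real.exp a), Φ x
      = ∫⁻ s in Ioi a, ENNReal.ofReal (Real.exp s) * Φ (Real.exp s) := by
  have himage : Real.exp '' Ioi a = Ioi (Real.exp a) := by
    ext x
    refine ⟨?_, fun hx => ?_⟩
    · rintro ⟨s, hs, rfl⟩
      exact Real.exp_lt_exp.2 hs
    · have hx0 : 0 < x := (Real.exp_pos a).trans hx
      exact ⟨Real.log x, (Real.lt_log_iff_exp_lt hx0).2 hx, Real.exp_log hx0⟩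
  rw [← himage, lintegral_image_eq_lintegral_abs_deriv_mul measurableSet_Ioi
    (fun x _ => (Real.hasDerivAt_exp x).hasDerivWithinAt) Real.exp_injective.injOn]
  simp only [Real.abs_exp]

theorem lintegral_Ioi_zero_eq_lintegral_exp (Φ : ℝ → ENNReal) :
    ∫⁻ x in Ioi (0 : ℝ), Φ x = ∫⁻ s, ENNReal.ofReal (Real.exp s) * Φ (Real.exp s) := by
  rw [← Real.range_exp, ← image_univ, lintegral_image_eq_lintegral_abs_deriv_mul MeasurableSet.univ
    (fun x _ => (Real.hasDerivAt_exp x).hasDerivWithinAt) Real.exp_injective.injOn]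
  simp only [Real.abs_exp, setLIntegral_univ]

theorem lintegral_rpow_mul_rpow_eq_lintegral_exp {p : ℝ} (hp : 0 < p) (σ : ℝ) {f : ℝ → ℝ}
    (hf0 : ∀ x ∈ Ioi (0 : ℝ), 0 ≤ f x) :
    ∫⁻ x in Ioi (0 : ℝ), ENNReal.ofReal (x ^ (p * (1 - σ) - 1) * f x ^ p)
      = ∫⁻ s, ENNReal.ofReal (Real.exp ((1 - σ) * s) * f (Real.exp s)) ^ p := by
  rw [lintegral_Ioi_zero_eq_lintegral_exp]
  refine lintegral_congr fun s => ?_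
  have hfs := hf0 _ (Real.exp_pos s)
  rw [← ENNReal.ofReal_mul (Real.exp_pos s).le, ENNReal.ofReal_rpow_of_nonneg (by positivity) hp.le,
    Real.mul_rpow (Real.exp_pos _).le hfs, ← Real.exp_mul, ← Real.exp_mul, ← mul_assoc,
    ← Real.exp_add]
  ring_nf

/-- Second-kind Hardy-type inequality with non-homogeneous kernel:
`∫₀^∞ (∫_{1/y}^∞ h(xy) f(x) dx) g(y) dy
  < k⁽²⁾(σ) (∫₀^∞ x^{p(1-σ)-1} f^p)^{1/p} (∫₀^∞ y^{q(1-σ)-1} g^q)^{1/q}`,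
where `k⁽²⁾(σ) = ∫₁^∞ h(t) t^{σ-1} dt`. -/
theorem stmt12 (p q σ : ℝ) (hp : 1 < p) (hpq : 1 / p + 1 / q = 1)
    (h : ℝ → ℝ) (hh : Measurable h) (hh0 : ∀ t ∈ Ioi (0 : ℝ), 0 ≤ h t)
    (hk0 : 0 < ∫⁻ t in Ioi (1 : ℝ), ENNReal.ofReal (h t * t ^ (σ - 1)))
    (hk1 : (∫⁻ t in Ioi (1 : ℝ), ENNReal.ofReal (h t * t ^ (σ - 1))) < ⊤)
    (f g : ℝ → ℝ) (hf : Measurable f) (hg : Measurable g)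
    (hf0 : ∀ x ∈ Ioi (0 : ℝ), 0 ≤ f x) (hg0 : ∀ y ∈ Ioi (0 : ℝ), 0 ≤ g y)
    (hA0 : 0 < ∫⁻ x in Ioi (0 : ℝ), ENNReal.ofReal (x ^ (p * (1 - σ) - 1) * f x ^ p))
    (hA1 : (∫⁻ x in Ioi (0 : ℝ), ENNReal.ofReal (x ^ (p * (1 - σ) - 1) * f x ^ p)) < ⊤)
    (hB0 : 0 < ∫⁻ y in Ioi (0 : ℝ), ENNReal.ofReal (y ^ (q * (1 - σ) - 1) * g y ^ q))
    (hB1 : (∫⁻ y in Ioi (0 : ℝ), ENNReal.ofReal (y ^ (q * (1 - σ) - 1) * g y ^ q)) < ⊤) :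
    (∫⁻ y in Ioi (0 : ℝ),
        (∫⁻ x in Ioi (1 / y), ENNReal.ofReal (h (x * y) * f x)) *
          ENNReal.ofReal (g y))
      < (∫⁻ t in Ioi (1 : ℝ), ENNReal.ofReal (h t * t ^ (σ - 1))) *
          (∫⁻ x in Ioi (0 : ℝ), ENNReal.ofReal (x ^ (p * (1 - σ) - 1) * f x ^ p)) ^ (1 / p) *
          (∫⁻ y in Ioi (0 : ℝ), ENNReal.ofReal (y ^ (q * (1 - σ) - 1) * g y ^ q)) ^ (1 / q) := by
  have hpq' : p.HolderConjugate q := by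
    rw [Real.holderConjugate_iff]
    exact ⟨hp, by simpa only [one_div] using hpq⟩
  set w : ℝ → ENNReal := (Ioi (0 : ℝ)).indicator
    fun s => ENNReal.ofReal (h (Real.exp s) * Real.exp (σ * s)) with hw
  set u : ℝ → ENNReal := fun s => ENNReal.ofReal (Real.exp ((1 - σ) * s) * f (Real.exp s)) with hu
  set v : ℝ → ENNReal := fun s => ENNReal.ofReal (Real.exp ((1 - σ) * s) * g (Real.exp s)) with hv
  have hwm : Measurable w := Measurable.indicator (by fun_prop) measurableSet_Ioi
  have hum : Measurable u := by fun_prop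
  have hvm : Measurable v := by fun_prop
  have hk : ∫⁻ t in Ioi (1 : ℝ), ENNReal.ofReal (h t * t ^ (σ - 1)) = ∫⁻ s, w s := by
    have hIoi := lintegral_Ioi_exp 0 fun t => ENNReal.ofReal (h t * t ^ (σ - 1))
    rw [Real.exp_zero] at hIoi
    rw [hIoi, hw, lintegral_indicator measurableSet_Ioi]
    refine lintegral_congr fun s => ?_
    rw [← ENNReal.ofReal_mul (Real.exp_pos s).le, ← Real.exp_mul, mul_left_comm, ← Real.exp_add]
    ring_nf
  have hA := lintegral_rpow_mul_rpow_eq_lintegral_exp hpq'.pos σ hf0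
  have hB := lintegral_rpow_mul_rpow_eq_lintegral_exp hpq'.symm.pos σ hg0
  have hL : (∫⁻ y in Ioi (0 : ℝ),
      (∫⁻ x in Ioi (1 / y), ENNReal.ofReal (h (x * y) * f x)) * ENNReal.ofReal (g y))
      = ∫⁻ r, (∫⁻ s, w (s + r) * u s) * v r := by
    rw [lintegral_Ioi_zero_eq_lintegral_exp]
    refine lintegral_congr fun r => ?_
    rw [one_div, ← Real.exp_neg, lintegral_Ioi_exp, ← lintegral_indicator measurableSet_Ioi,
      ← lintegral_mul_const _ (Measurable.indicator (by fun_prop) measurableSet_Ioi),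
      ← lintegral_const_mul _ ((Measurable.indicator (by fun_prop) measurableSet_Ioi).mul_const _),
      ← lintegral_mul_const _ (by fun_prop)]
    refine lintegral_congr fun s => ?_
    by_cases hs : -r < s
    · have hsr : 0 < s + r := by linarith
      have hfs := hf0 _ (Real.exp_pos s)
      have hhs := hh0 _ (Real.exp_pos (s + r))
      simp only [hw, hu, hv, indicator_of_mem (mem_Ioi.2 hs), indicator_of_mem (mem_Ioi.2 hsr),
        ← Real.exp_add]
      have hexp : Real.exp r * Real.exp s
          = Real.exp (σ * (s + r)) * Real.exp ((1 - σ) * s) * Real.exp ((1 - σ) * r) := by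
        simp only [← Real.exp_add]
        ring_nf
      rw [← ENNReal.ofReal_mul (by positivity), ← ENNReal.ofReal_mul (by positivity),
        ← ENNReal.ofReal_mul (by positivity), ← ENNReal.ofReal_mul (by positivity),
        ← ENNReal.ofReal_mul (by positivity)]
      congr 1
      linear_combination h (Real.exp (s + r)) * f (Real.exp s) * g (Real.exp r) * hexp
    · have hsr : ¬ 0 < s + r := by linarith
      simp [hw, hs, hsr]
  rw [hk] at hk0 hk1
  rw [hA] at hA0 hA1
  rw [hB] at hB0 hB1
  rw [hL, hk, hA, hB]
  exact lintegral_convolution_lt_s12 hpq' hwm hum hvm hk0.ne' hk1.ne hA0.ne' hA1.ne hB0.ne' hB1.ne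
end
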